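/- Let β > 0 and let k satisfy 0 < k < 3/(3+β). Then Q⁺⁻(k) = {(x,y,z) ∈ ℝ³ : β(x²y²+y²z²+z²x²) + (x²+y²+z²−1/2)² − (1−k)/4 = 0} has exactly two connected components, and each of these components is compact and homeomorphic to the 2-sphere. -/

import Mathlib

/-- The elementary symmetric function `x²y² + y²z² + z²x²` on `ℝ³`. -/
def symmQuartic (p : EuclideanSpace ℝ (Fin 3)) : ℝ :=
  (p 0)^2*(p 1)^2 + (p 1)^2*(p 2)^2 + (p 2)^2*(p 0)^2

/-- The octahedral quartic surface with parameters `β` and `k`. -/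
def octahedralQuartic (β k : ℝ) : Set (EuclideanSpace ℝ (Fin 3)) :=
  {p | β * symmQuartic p + (‖p‖^2 - 1/2)^2 - (1 - k)/4 = 0}

/-- The squared distance from the origin to the quartic in the unit direction `n`, on the outer
sheet for `ε = 1` and on the inner sheet for `ε = -1`. -/
noncomputable def sheetRadiusSq (β k ε : ℝ) (n : EuclideanSpace ℝ (Fin 3)) : ℝ :=
  (1 + ε * √(1 - k * (1 + β * symmQuartic n))) / (2 * (1 + β * symmQuartic n))

/-- The radial parametrization of a sheet of the quartic by the unit sphere. -/
noncomputable def sheetMap (β k ε : ℝ)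
    (n : Metric.sphere (0 : EuclideanSpace ℝ (Fin 3)) 1) : EuclideanSpace ℝ (Fin 3) :=
  √(sheetRadiusSq β k ε n) • (n : EuclideanSpace ℝ (Fin 3))

/-- The part of the quartic outside (`ε = 1`) or inside (`ε = -1`) the sphere `‖p‖² = k/2`. -/
def sheet (β k ε : ℝ) : Set (EuclideanSpace ℝ (Fin 3)) :=
  octahedralQuartic β k ∩ {p | 0 < ε * (‖p‖^2 - k/2)}

lemma norm_sq_eq_sum_three (p : EuclideanSpace ℝ (Fin 3)) :
    ‖p‖^2 = (p 0)^2 + (p 1)^2 + (p 2)^2 := by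
  rw [EuclideanSpace.real_norm_sq_eq, Fin.sum_univ_three]

lemma symmQuartic_nonneg (p : EuclideanSpace ℝ (Fin 3)) : 0 ≤ symmQuartic p := by
  unfold symmQuartic; positivity

lemma three_mul_symmQuartic_le (p : EuclideanSpace ℝ (Fin 3)) :
    3 * symmQuartic p ≤ (‖p‖^2)^2 := by
  rw [norm_sq_eq_sum_three]
  unfold symmQuartic
  nlinarith [sq_nonneg ((p 0)^2 - (p 1)^2), sq_nonneg ((p 1)^2 - (p 2)^2),
    sq_nonneg ((p 2)^2 - (p 0)^2)]

lemma symmQuartic_smul (r : ℝ) (p : EuclideanSpace ℝ (Fin 3)) :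
    symmQuartic (r • p) = (r^2)^2 * symmQuartic p := by
  simp only [symmQuartic, PiLp.smul_apply, smul_eq_mul]; ring

lemma continuous_symmQuartic : Continuous symmQuartic := by
  unfold symmQuartic; fun_prop

lemma norm_sq_pos_of_mem_octahedralQuartic {β k : ℝ} (hk : 0 < k)
    {p : EuclideanSpace ℝ (Fin 3)} (hp : p ∈ octahedralQuartic β k) : 0 < ‖p‖^2 := by
  rcases eq_or_ne p 0 with rfl | h
  · simp [octahedralQuartic, symmQuartic] at hp
    linarith
  · positivity

lemma continuous_sheetMap {β k ε : ℝ} (hβ : 0 < β) : Continuous (sheetMap β k ε) := by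
  have hc : Continuous fun n : Metric.sphere (0 : EuclideanSpace ℝ (Fin 3)) 1 =>
      symmQuartic n := continuous_symmQuartic.comp continuous_subtype_val
  unfold sheetMap sheetRadiusSq
  refine (Continuous.sqrt (Continuous.div (by fun_prop) (by fun_prop) fun n => ?_)).smul
    continuous_subtype_val
  have := symmQuartic_nonneg (n : EuclideanSpace ℝ (Fin 3))
  positivity

section

variable {β k ε : ℝ} (hβ : 0 < β) (hk0 : 0 < k) (hk1 : k < 3/(3+β))
include hβ hk0 hk1

lemma discriminant_pos {v : ℝ} (hv : 3 * v ≤ 1) : 0 < 1 - k * (1 + β * v) := by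
  rw [lt_div_iff₀ (by positivity)] at hk1
  nlinarith [mul_pos hk0 hβ, mul_nonneg (mul_pos hk0 hβ).le (sub_nonneg.2 hv)]

lemma sq_norm_sub_pos {p : EuclideanSpace ℝ (Fin 3)} (hp : p ∈ octahedralQuartic β k) :
    0 < (‖p‖^2 - k/2)^2 := by
  have hu := norm_sq_pos_of_mem_octahedralQuartic hk0 hp
  have h3 := three_mul_symmQuartic_le p
  have hv := symmQuartic_nonneg p
  have hd := discriminant_pos hβ hk0 hk1 (v := symmQuartic p / (‖p‖^2)^2)
    (by rw [← mul_div_assoc]; exact div_le_one_of_le₀ h3 (by positivity))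
  simp only [octahedralQuartic, Set.mem_ofPred_eq] at hp
  have : (‖p‖^2 - k/2)^2 = (1 - k * (1 + β * (symmQuartic p / (‖p‖^2)^2))) * (‖p‖^2)^2 := by
    generalize ‖p‖^2 = u at hp hu ⊢
    field_simp
    linear_combination (4 * k) * hp
  rw [this]; positivity

lemma sheetRadiusSq_spec (hε : ε^2 = 1) (n : Metric.sphere (0 : EuclideanSpace ℝ (Fin 3)) 1) :
    0 < sheetRadiusSq β k ε n ∧
    (1 + β * symmQuartic n) * (sheetRadiusSq β k ε n)^2 - sheetRadiusSq β k ε n + k/4 = 0 ∧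
    0 < ε * (sheetRadiusSq β k ε n - k/2) := by
  have hv := symmQuartic_nonneg (n : EuclideanSpace ℝ (Fin 3))
  have hn : ‖(n : EuclideanSpace ℝ (Fin 3))‖ = 1 := by simp
  have hd := discriminant_pos hβ hk0 hk1 (v := symmQuartic n)
    (by simpa [hn] using three_mul_symmQuartic_le (n : EuclideanSpace ℝ (Fin 3)))
  have hc : 0 < 1 + β * symmQuartic (n : EuclideanSpace ℝ (Fin 3)) := by positivity
  unfold sheetRadiusSq
  generalize 1 + β * symmQuartic (n : EuclideanSpace ℝ (Fin 3)) = c at hd hc ⊢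
  have hs := Real.sqrt_pos.2 hd
  have hs2 := Real.sq_sqrt hd.le
  generalize √(1 - k * c) = s at hs hs2 ⊢
  have hs1 : s < 1 := by nlinarith [mul_pos hk0 hc]
  have hpos : 0 < 1 + ε * s := by
    rcases sq_eq_sq_iff_eq_or_eq_neg.1 (hε.trans (one_pow 2).symm) with rfl | rfl <;> linarith
  have hroot : 0 < (1 + ε * s) / (2 * c) := by positivity
  have heq : c * ((1 + ε * s) / (2 * c))^2 - (1 + ε * s) / (2 * c) + k/4 = 0 := by
    field_simp
    linear_combination 4 * s^2 * hε + 4 * hs2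
  refine ⟨hroot, heq, ?_⟩
  have : ε * ((1 + ε * s) / (2 * c) - k/2) = (1 + ε * s) / (2 * c) * s := by
    have h2 : (1 + ε * s) / (2 * c) - k/2 = (1 + ε * s) / (2 * c) * (ε * s) := by
      have : 2 * c * ((1 + ε * s) / (2 * c)) = 1 + ε * s := by field_simp
      linear_combination -2 * heq + (1 + ε * s) / (2 * c) * this
    rw [h2]
    linear_combination (1 + ε * s) / (2 * c) * s * hε
  rw [this]; positivity

lemma norm_sq_sheetMap (hε : ε^2 = 1) (n : Metric.sphere (0 : EuclideanSpace ℝ (Fin 3)) 1) :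
    ‖sheetMap β k ε n‖^2 = sheetRadiusSq β k ε n := by
  have h := (sheetRadiusSq_spec hβ hk0 hk1 hε n).1
  simp [sheetMap, norm_smul, abs_of_nonneg, Real.sq_sqrt h.le]

lemma range_sheetMap (hε : ε^2 = 1) : Set.range (sheetMap β k ε) = sheet β k ε := by
  ext p
  constructor
  · rintro ⟨n, rfl⟩
    obtain ⟨h0, h1, h2⟩ := sheetRadiusSq_spec hβ hk0 hk1 hε n
    refine ⟨?_, ?_⟩
    · simp only [octahedralQuartic, Set.mem_ofPred_eq, norm_sq_sheetMap hβ hk0 hk1 hε]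
      rw [sheetMap, symmQuartic_smul, Real.sq_sqrt h0.le]
      linear_combination h1
    · simpa only [Set.mem_ofPred_eq, norm_sq_sheetMap hβ hk0 hk1 hε] using h2
  · rintro ⟨hp, hs⟩
    have hu := norm_sq_pos_of_mem_octahedralQuartic hk0 hp
    have hp0 : ‖p‖ ≠ 0 := fun h => by simp [h] at hu
    have hv := symmQuartic_nonneg p
    refine ⟨⟨‖p‖⁻¹ • p, by simp [norm_smul, hp0]⟩, ?_⟩
    have key : sheetRadiusSq β k ε (‖p‖⁻¹ • p) = ‖p‖^2 := by
      simp only [octahedralQuartic, Set.mem_ofPred_eq] at hp hs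
      rw [sheetRadiusSq, symmQuartic_smul, inv_pow]
      generalize ‖p‖^2 = u at hp hs hu ⊢
      generalize symmQuartic p = v at hp hv ⊢
      have hsq : 1 - k * (1 + β * (u⁻¹^2 * v)) = (ε * (u - k/2) / u)^2 := by
        field_simp
        linear_combination (-4 * k) * hp - (2 * u - k)^2 * hε
      rw [hsq, Real.sqrt_sq (by positivity), div_eq_iff (by positivity)]
      field_simp
      linear_combination (2 * u - k) * hε - 4 * hp
    simp only [sheetMap, key, Real.sqrt_sq (norm_nonneg p)]
    rw [smul_smul, mul_inv_cancel₀ hp0, one_smul]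

lemma injective_sheetMap (hε : ε^2 = 1) : Function.Injective (sheetMap β k ε) := by
  intro m n h
  have hr : sheetRadiusSq β k ε m = sheetRadiusSq β k ε n := by
    rw [← norm_sq_sheetMap hβ hk0 hk1 hε, ← norm_sq_sheetMap hβ hk0 hk1 hε, h]
  have hpos := (sheetRadiusSq_spec hβ hk0 hk1 hε n).1
  simp only [sheetMap, hr] at h
  exact Subtype.ext (smul_right_injective _ (Real.sqrt_pos.2 hpos).ne' h)

lemma nonempty_sheet_homeomorph (hε : ε^2 = 1) :
    Nonempty (sheet β k ε ≃ₜ Metric.sphere (0 : EuclideanSpace ℝ (Fin 3)) 1) := by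
  rw [← range_sheetMap hβ hk0 hk1 hε]
  exact ⟨((continuous_sheetMap hβ).isClosedEmbedding
    (injective_sheetMap hβ hk0 hk1 hε)).isEmbedding.toHomeomorph.symm⟩

lemma isCompact_sheet (hε : ε^2 = 1) : IsCompact (sheet β k ε) := by
  rw [← range_sheetMap hβ hk0 hk1 hε]
  exact isCompact_range (continuous_sheetMap hβ)

lemma isConnected_sheet (hε : ε^2 = 1) : IsConnected (sheet β k ε) := by
  have : ConnectedSpace (Metric.sphere (0 : EuclideanSpace ℝ (Fin 3)) 1) :=
    isConnected_iff_connectedSpace.1 <| isConnected_sphere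
      (by rw [← Module.finrank_eq_rank, finrank_euclideanSpace_fin]; norm_num) 0 zero_le_one
  rw [← range_sheetMap hβ hk0 hk1 hε]
  exact isConnected_range (continuous_sheetMap hβ)

lemma connectedComponentIn_eq_sheet (hε : ε^2 = 1) {p : EuclideanSpace ℝ (Fin 3)}
    (hp : p ∈ sheet β k ε) : connectedComponentIn (octahedralQuartic β k) p = sheet β k ε := by
  refine Set.Subset.antisymm (fun q hq => ⟨connectedComponentIn_subset _ _ hq, ?_⟩)
    ((isConnected_sheet hβ hk0 hk1 hε).isPreconnected.subset_connectedComponentIn hp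
      Set.inter_subset_left)
  refine isPreconnected_connectedComponentIn.subset_left_of_subset_union
    (u := {p | 0 < ε * (‖p‖^2 - k/2)}) (v := {p | ε * (‖p‖^2 - k/2) < 0})
    (isOpen_lt (by fun_prop) (by fun_prop)) (isOpen_lt (by fun_prop) (by fun_prop))
    (Set.disjoint_left.2 fun x (h : 0 < ε * (‖x‖^2 - k/2)) (h' : ε * (‖x‖^2 - k/2) < 0) =>
      lt_asymm h h') (fun x hx => ?_)
    ⟨p, mem_connectedComponentIn hp.1, hp.2⟩ hq
  have h := sq_norm_sub_pos hβ hk0 hk1 (connectedComponentIn_subset _ _ hx)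
  suffices hne : ε * (‖x‖^2 - k/2) ≠ 0 from (lt_or_gt_of_ne hne).symm
  intro h0
  have : (ε * (‖x‖^2 - k/2))^2 = (‖x‖^2 - k/2)^2 := by rw [mul_pow, hε, one_mul]
  rw [h0] at this
  linarith

lemma mem_sheet_or_mem_sheet {p : EuclideanSpace ℝ (Fin 3)} (hp : p ∈ octahedralQuartic β k) :
    p ∈ sheet β k 1 ∨ p ∈ sheet β k (-1) := by
  have h := sq_norm_sub_pos hβ hk0 hk1 hp
  rcases lt_trichotomy (‖p‖^2 - k/2) 0 with h' | h' | h'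
  · exact Or.inr ⟨hp, by simp only [Set.mem_ofPred_eq]; linarith⟩
  · simp [h'] at h
  · exact Or.inl ⟨hp, by simp only [Set.mem_ofPred_eq]; linarith⟩

lemma card_connectedComponents_octahedralQuartic :
    Nat.card (ConnectedComponents (octahedralQuartic β k)) = 2 := by
  have h1 : (1 : ℝ)^2 = 1 := by norm_num
  have h2 : (-1 : ℝ)^2 = 1 := by norm_num
  obtain ⟨a, ha⟩ := (isConnected_sheet hβ hk0 hk1 h1).nonempty
  obtain ⟨b, hb⟩ := (isConnected_sheet hβ hk0 hk1 h2).nonempty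
  have himage : ∀ x : octahedralQuartic β k, Subtype.val '' connectedComponent x =
      connectedComponentIn (octahedralQuartic β k) x := fun x =>
    (connectedComponentIn_eq_image x.2).symm
  have hsame : ∀ {ε : ℝ}, ε^2 = 1 → ∀ {x y : octahedralQuartic β k},
      (x : EuclideanSpace ℝ (Fin 3)) ∈ sheet β k ε → (y : EuclideanSpace ℝ (Fin 3)) ∈ sheet β k ε →
      (x : ConnectedComponents (octahedralQuartic β k)) = y := by
    intro ε hε x y hx hy
    rw [ConnectedComponents.coe_eq_coe]
    apply Subtype.val_injective.image_injective
    rw [himage, himage, connectedComponentIn_eq_sheet hβ hk0 hk1 hε hx,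
      connectedComponentIn_eq_sheet hβ hk0 hk1 hε hy]
  rw [Nat.card_eq_two_iff]
  refine ⟨((⟨a, ha.1⟩ : octahedralQuartic β k) : ConnectedComponents _),
    ((⟨b, hb.1⟩ : octahedralQuartic β k) : ConnectedComponents _), fun h => ?_, ?_⟩
  · rw [ConnectedComponents.coe_eq_coe] at h
    have h := congrArg (Set.image Subtype.val) h
    rw [himage, himage, connectedComponentIn_eq_sheet hβ hk0 hk1 h1 ha,
      connectedComponentIn_eq_sheet hβ hk0 hk1 h2 hb] at h
    have hab : a ∈ sheet β k (-1) := h ▸ ha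
    have hpos : 0 < 1 * (‖a‖^2 - k/2) := ha.2
    have hneg : 0 < -1 * (‖a‖^2 - k/2) := hab.2
    linarith
  · refine Set.eq_univ_of_forall fun x => ?_
    obtain ⟨x, rfl⟩ := ConnectedComponents.surjective_coe x
    rcases mem_sheet_or_mem_sheet hβ hk0 hk1 x.2 with hx | hx
    · exact Or.inl (hsame h1 hx ha)
    · exact Or.inr (hsame h2 hx hb)

end

/-- for `β > 0` and `0 < k < 3/(3+β)`, the quartic `Q⁺⁻(k)` has exactly
two connected components, each compact and homeomorphic to the 2-sphere. -/
theorem stmt_10 (β k : ℝ) (hβ : 0 < β) (hk0 : 0 < k) (hk1 : k < 3/(3+β))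
    (Q : Set (EuclideanSpace ℝ (Fin 3)))
    (hQ : Q = {p | β * ((p 0)^2*(p 1)^2 + (p 1)^2*(p 2)^2 + (p 2)^2*(p 0)^2)
        + ((p 0)^2 + (p 1)^2 + (p 2)^2 - 1/2)^2 - (1 - k)/4 = 0}) :
    Nat.card (ConnectedComponents ↥Q) = 2 ∧
    ∀ p ∈ Q, IsCompact (connectedComponentIn Q p) ∧
      Nonempty (↥(connectedComponentIn Q p) ≃ₜ
        ↥(Metric.sphere (0 : EuclideanSpace ℝ (Fin 3)) 1)) := by
  have hQ : Q = octahedralQuartic β k := by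
    simp only [hQ, octahedralQuartic, symmQuartic, norm_sq_eq_sum_three]
  subst hQ
  refine ⟨card_connectedComponents_octahedralQuartic hβ hk0 hk1, fun p hp => ?_⟩
  rcases mem_sheet_or_mem_sheet hβ hk0 hk1 hp with h | h
  · rw [connectedComponentIn_eq_sheet hβ hk0 hk1 (by norm_num) h]
    exact ⟨isCompact_sheet hβ hk0 hk1 (by norm_num),
      nonempty_sheet_homeomorph hβ hk0 hk1 (by norm_num)⟩
  · rw [connectedComponentIn_eq_sheet hβ hk0 hk1 (by norm_num) h]
    exact ⟨isCompact_sheet hβ hk0 hk1 (by norm_num),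
      nonempty_sheet_homeomorph hβ hk0 hk1 (by norm_num)⟩
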